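/- Let R = ⟨v_0, …, v_k⟩ be a partial route and let t, s ∈ ℝ with t ≥ a(v_0). Then R is feasible for t with δ(R, t) ≤ s if and only if there exist real numbers t_0, …, t_k such that t_0 ≥ t, a(v_i) ≤ t_i ≤ b(v_i) for every i ∈ {0, …, k}, t_i ≥ t_{i−1} + τ(v_{i−1}, v_i) for every i ∈ {1, …, k}, and t_k ≤ s. -/

import Mathlib

noncomputable section

attribute [local instance] Classical.propDecidable

/-- `delta τ a r t i`: earliest arrival time at the `i`-th vertex of the partial route
`⟨r 0, …, r k⟩` when the vehicle departs from `r 0` at time `t`, taking waiting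
times (lower time-window bounds `a`) into account. -/
def delta (τ : ℕ → ℕ → ℝ) (a : ℕ → ℝ) (r : ℕ → ℕ) (t : ℝ) : ℕ → ℝ
  | 0 => max t (a (r 0))
  | i + 1 => max (delta τ a r t i + τ (r i) (r (i + 1))) (a (r (i + 1)))

/-- The partial route `⟨r 0, …, r k⟩` is feasible for departure time `t`:
the departure is not before `a (r 0)` and every vertex is reached before the
end `b` of its time window. -/
def Feasible (τ : ℕ → ℕ → ℝ) (a b : ℕ → ℝ) (r : ℕ → ℕ) (k : ℕ) (t : ℝ) : Prop :=
  a (r 0) ≤ t ∧ ∀ i ≤ k, delta τ a r t i ≤ b (r i)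

theorem le_delta_zero (τ : ℕ → ℕ → ℝ) (a : ℕ → ℝ) (r : ℕ → ℕ) (t : ℝ) :
    t ≤ delta τ a r t 0 :=
  le_max_left _ _

theorem window_le_delta (τ : ℕ → ℕ → ℝ) (a : ℕ → ℝ) (r : ℕ → ℕ) (t : ℝ) (i : ℕ) :
    a (r i) ≤ delta τ a r t i := by
  cases i <;> exact le_max_right _ _

theorem delta_add_travel_le (τ : ℕ → ℕ → ℝ) (a : ℕ → ℝ) (r : ℕ → ℕ) (t : ℝ) (i : ℕ) :
    delta τ a r t i + τ (r i) (r (i + 1)) ≤ delta τ a r t (i + 1) :=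
  le_max_left _ _

/-- `delta` is the pointwise least schedule departing no earlier than `t`. -/
theorem delta_le_of_schedule {τ : ℕ → ℕ → ℝ} {a : ℕ → ℝ} {r : ℕ → ℕ} {k : ℕ} {t : ℝ}
    {f : ℕ → ℝ} (h0 : t ≤ f 0) (ha : ∀ i ≤ k, a (r i) ≤ f i)
    (hτ : ∀ i < k, f i + τ (r i) (r (i + 1)) ≤ f (i + 1)) :
    ∀ i ≤ k, delta τ a r t i ≤ f i := by
  intro i
  induction i with
  | zero => exact fun hi => max_le h0 (ha 0 hi)
  | succ i ih =>
    intro hi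
    exact max_le ((add_le_add_left (ih (by omega)) _).trans (hτ i hi)) (ha _ hi)

/-- Schedule characterization: for `t ≥ a (r 0)`, the partial route
`R = ⟨r 0, …, r k⟩` is feasible for `t` with `δ(R, t) ≤ s` iff there are times
`f 0, …, f k` with `f 0 ≥ t`, `a (r i) ≤ f i ≤ b (r i)` for all `i`,
`f (i+1) ≥ f i + τ (r i) (r (i+1))`, and `f k ≤ s`. -/
theorem stmt14 (τ : ℕ → ℕ → ℝ) (a b : ℕ → ℝ) (r : ℕ → ℕ) (k : ℕ) (t s : ℝ)
    (ht : a (r 0) ≤ t) :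
    (Feasible τ a b r k t ∧ delta τ a r t k ≤ s) ↔
      ∃ f : ℕ → ℝ, t ≤ f 0 ∧ (∀ i ≤ k, a (r i) ≤ f i ∧ f i ≤ b (r i)) ∧
        (∀ i < k, f i + τ (r i) (r (i + 1)) ≤ f (i + 1)) ∧ f k ≤ s := by
  constructor
  · rintro ⟨⟨-, hb⟩, hs⟩
    exact ⟨delta τ a r t, le_delta_zero τ a r t,
      fun i hi => ⟨window_le_delta τ a r t i, hb i hi⟩,
      fun i _ => delta_add_travel_le τ a r t i, hs⟩
  · rintro ⟨f, h0, hw, hτ, hs⟩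
    have hle := delta_le_of_schedule h0 (fun i hi => (hw i hi).1) hτ
    exact ⟨⟨ht, fun i hi => (hle i hi).trans (hw i hi).2⟩, (hle k le_rfl).trans hs⟩
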